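/- arXiv:2308.09726 — 3 statements merged into one kernel-verified Lean document; each statement's English description precedes it below -/
import Mathlib

section
/- The Lagrangian bound is tight at full budget: for every joint state s, L s N = V 0 s N. (Established in the proof of Theorem 3.) -/
open Finset

noncomputable def Vval (N : ℕ) {S : Type} [Fintype S]
    (P : Fin N → S → Bool → S → ℝ) (R : S → ℝ) (H : ℕ)
    (t : ℕ) (s : Fin N → S) (b : ℕ) : ℝ :=
  if _h : t < H then
    (Finset.univ.filter (fun a : Fin N → Bool =>
        (Finset.univ.filter (fun n => a n = true)).card ≤ b)).sup'
      ⟨fun _ => false, by simp⟩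
      (fun a => (∑ n : Fin N, R (s n)) +
        ∑ s' : Fin N → S, (∏ n : Fin N, P n (s n) (a n) (s' n)) * Vval N P R H (t+1) s' b)
  else 0
termination_by H - t
decreasing_by omega

noncomputable def vCharged (N : ℕ) {S : Type} [Fintype S]
    (P : Fin N → S → Bool → S → ℝ) (R : S → ℝ) (H : ℕ)
    (n : Fin N) (lam : Fin H → ℝ) (t : ℕ) (x : S) : ℝ :=
  if h : t < H then
    max (R x + ∑ s' : S, P n x false s' * vCharged N P R H n lam (t+1) s')
        ((R x - lam ⟨t, h⟩) + ∑ s' : S, P n x true s' * vCharged N P R H n lam (t+1) s')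
  else 0
termination_by H - t
decreasing_by all_goals omega

noncomputable def Lag (N : ℕ) {S : Type} [Fintype S]
    (P : Fin N → S → Bool → S → ℝ) (R : S → ℝ) (H : ℕ)
    (s : Fin N → S) (β : ℝ) : ℝ :=
  sInf {z : ℝ | ∃ lam : Fin H → ℝ, (∀ k, 0 ≤ lam k) ∧
    z = (∑ n : Fin N, vCharged N P R H n lam 0 (s n)) + β * ∑ k : Fin H, lam k}

theorem marg_aux (N : ℕ) {S : Type} [Fintype S] (p : Fin N → S → ℝ)
    (h1 : ∀ n, ∑ x, p n x = 1) (m : Fin N) (g : S → ℝ) :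
    ∑ s' : Fin N → S, (∏ n, p n (s' n)) * g (s' m) = ∑ x, p m x * g x := by
  classical
  have h := Fintype.prod_sum (fun (n : Fin N) (x : S) => p n x * (if n = m then g x else 1))
  have h2 : ∀ s' : Fin N → S,
      (∏ n, p n (s' n) * (if n = m then g (s' n) else 1)) = (∏ n, p n (s' n)) * g (s' m) := by
    intro s'
    rw [Finset.prod_mul_distrib]
    simp
  simp only [h2] at h
  rw [← h, Finset.prod_eq_single m]
  · simp
  · intro n _ hn
    simp [hn, h1]
  · simp

theorem joint_aux (N : ℕ) {S : Type} [Fintype S] (p : Fin N → S → ℝ)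
    (h1 : ∀ n, ∑ x, p n x = 1) (f : Fin N → S → ℝ) :
    ∑ s' : Fin N → S, (∏ n, p n (s' n)) * ∑ m, f m (s' m) = ∑ m, ∑ x, p m x * f m x := by
  simp only [Finset.mul_sum]
  rw [Finset.sum_comm]
  exact Finset.sum_congr rfl fun m _ => marg_aux N p h1 m (f m)

theorem V_decomp (N : ℕ) {S : Type} [Fintype S]
    (P : Fin N → S → Bool → S → ℝ)
    (hP1 : ∀ (n : Fin N) (x : S) (a : Bool), ∑ x' : S, P n x a x' = 1)
    (R : S → ℝ) (H : ℕ) (d : ℕ) : ∀ (t : ℕ) (_ : H - t = d) (s : Fin N → S),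
    Vval N P R H t s N = ∑ n, vCharged N P R H n 0 t (s n) := by
  induction d with
  | zero =>
    intro t ht s
    have h : ¬ t < H := by omega
    rw [Vval, dif_neg h]
    symm
    apply Finset.sum_eq_zero
    intro n _
    rw [vCharged, dif_neg h]
  | succ d ih =>
    intro t ht s
    have h : t < H := by omega
    have hv : ∀ n, vCharged N P R H n 0 t (s n) = max
        (R (s n) + ∑ x, P n (s n) false x * vCharged N P R H n 0 (t+1) x)
        (R (s n) + ∑ x, P n (s n) true x * vCharged N P R H n 0 (t+1) x) := by
      intro n
      rw [vCharged, dif_pos h]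
      simp
    have key : ∀ a : Fin N → Bool, (∑ n : Fin N, R (s n)) +
        ∑ s' : Fin N → S, (∏ n : Fin N, P n (s n) (a n) (s' n)) * Vval N P R H (t+1) s' N
        = ∑ n, (R (s n) + ∑ x, P n (s n) (a n) x * vCharged N P R H n 0 (t+1) x) := by
      intro a
      simp only [ih (t+1) (by omega)]
      rw [joint_aux N (fun n => P n (s n) (a n)) (fun n => hP1 n _ _)
        (fun n x => vCharged N P R H n 0 (t+1) x), Finset.sum_add_distrib]
    rw [Vval, dif_pos h]
    simp only [key]
    apply le_antisymm
    · apply Finset.sup'_le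
      intro a _
      apply Finset.sum_le_sum
      intro n _
      rw [hv]
      cases a n
      · exact le_max_left _ _
      · exact le_max_right _ _
    · have hex : ∀ n, ∃ b : Bool, vCharged N P R H n 0 t (s n) =
          R (s n) + ∑ x, P n (s n) b x * vCharged N P R H n 0 (t+1) x := by
        intro n
        rw [hv]
        rcases max_choice
          (R (s n) + ∑ x, P n (s n) false x * vCharged N P R H n 0 (t+1) x)
          (R (s n) + ∑ x, P n (s n) true x * vCharged N P R H n 0 (t+1) x) with e | e
        · exact ⟨false, e⟩
        · exact ⟨true, e⟩
      choose a ha using hex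
      rw [Finset.sum_congr rfl fun n _ => ha n]
      apply Finset.le_sup' (fun a : Fin N → Bool =>
        ∑ n, (R (s n) + ∑ x, P n (s n) (a n) x * vCharged N P R H n 0 (t+1) x))
      simp only [Finset.mem_filter, Finset.mem_univ, true_and]
      exact (Finset.card_le_univ _).trans (by simp)

theorem tail_aux (H : ℕ) (lam : Fin H → ℝ) (t : ℕ) (h : t < H) :
    (∑ k : Fin H, if t ≤ k.val then lam k else 0) =
      lam ⟨t, h⟩ + ∑ k : Fin H, if t + 1 ≤ k.val then lam k else 0 := by
  have e : lam ⟨t, h⟩ = ∑ k : Fin H, if k = ⟨t, h⟩ then lam k else 0 := by simp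
  rw [e, ← Finset.sum_add_distrib]
  apply Finset.sum_congr rfl
  intro k _
  rcases lt_trichotomy k.val t with hk | hk | hk
  · have h1 : ¬ t ≤ k.val := by omega
    have h2 : ¬ t + 1 ≤ k.val := by omega
    have h3 : k ≠ ⟨t, h⟩ := by rintro rfl; simp at hk
    simp [h1, h2, h3]
  · have h3 : k = ⟨t, h⟩ := Fin.ext hk
    subst h3
    simp
  · have h1 : t ≤ k.val := by omega
    have h2 : t + 1 ≤ k.val := by omega
    have h3 : k ≠ ⟨t, h⟩ := by rintro rfl; simp at hk
    simp only [h1, h2, h3, if_true, if_false, zero_add]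

theorem v_le (N : ℕ) {S : Type} [Fintype S]
    (P : Fin N → S → Bool → S → ℝ)
    (hP0 : ∀ (n : Fin N) (x : S) (a : Bool) (x' : S), 0 ≤ P n x a x')
    (hP1 : ∀ (n : Fin N) (x : S) (a : Bool), ∑ x' : S, P n x a x' = 1)
    (R : S → ℝ) (H : ℕ) (n : Fin N) (lam : Fin H → ℝ) (hl : ∀ k, 0 ≤ lam k) (d : ℕ) :
    ∀ (t : ℕ) (_ : H - t = d) (x : S),
    vCharged N P R H n 0 t x ≤ vCharged N P R H n lam t x +
      ∑ k : Fin H, if t ≤ k.val then lam k else 0 := by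
  induction d with
  | zero =>
    intro t ht x
    have h : ¬ t < H := by omega
    rw [vCharged, dif_neg h, vCharged, dif_neg h, zero_add]
    apply Finset.sum_nonneg
    intro k _
    split_ifs
    · exact hl k
    · exact le_rfl
  | succ d ih =>
    intro t ht x
    have h : t < H := by omega
    have step : ∀ a, ∑ y, P n x a y * vCharged N P R H n 0 (t+1) y ≤
        ∑ y, P n x a y * vCharged N P R H n lam (t+1) y +
          ∑ k : Fin H, if t + 1 ≤ k.val then lam k else 0 := by
      intro a
      calc _ ≤ ∑ y, P n x a y * (vCharged N P R H n lam (t+1) y +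
              ∑ k : Fin H, if t + 1 ≤ k.val then lam k else 0) :=
            Finset.sum_le_sum fun y _ =>
              mul_le_mul_of_nonneg_left (ih (t+1) (by omega) y) (hP0 n x a y)
        _ = _ := by
          simp only [mul_add]
          rw [Finset.sum_add_distrib, ← Finset.sum_mul, hP1, one_mul]
    rw [tail_aux H lam t h, vCharged, dif_pos h, vCharged.eq_def N P R H n lam t, dif_pos h]
    have h0 := step false
    have h1 := step true
    have hlt := hl ⟨t, h⟩
    apply max_le
    · refine le_trans ?_ (add_le_add_left (le_max_left _ _) _)
      linarith
    · refine le_trans ?_ (add_le_add_left (le_max_right _ _) _)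
      simp only [Pi.zero_apply]
      linarith

theorem L_tight_at_full_budget
    (N : ℕ) (S : Type) [Fintype S] [Nonempty S]
    (P : Fin N → S → Bool → S → ℝ)
    (hP0 : ∀ (n : Fin N) (x : S) (a : Bool) (x' : S), 0 ≤ P n x a x')
    (hP1 : ∀ (n : Fin N) (x : S) (a : Bool), ∑ x' : S, P n x a x' = 1)
    (R : S → ℝ) (H : ℕ)
    (s : Fin N → S) :
    Lag N P R H s (N : ℝ) = Vval N P R H 0 s N := by
  rw [V_decomp N P hP1 R H (H - 0) 0 rfl s]
  apply IsLeast.csInf_eq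
  constructor
  · exact ⟨0, fun _ => le_rfl, by simp⟩
  · rintro z ⟨lam, hl, rfl⟩
    have h := Finset.sum_le_sum fun (n : Fin N) (_ : n ∈ Finset.univ) =>
      v_le N P hP0 hP1 R H n lam hl (H - 0) 0 rfl (s n)
    simpa [Finset.sum_add_distrib] using h
end

section
/- Fixed-subset policy lower bound on the RMAB value function (the decoupled lower-bound policy used in the proof of Theorem 3): for every joint state s, every budget b : ℕ, and every subset T ⊆ Fin N with card T ≤ b, one has V 0 s b ≥ (∑_{n ∈ T} v n 0 (s n) 0̄) + (∑_{n ∉ T} v̲ n 0 (s n)). -/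
open Finset

noncomputable def vPassive (N : ℕ) {S : Type} [Fintype S]
    (P : Fin N → S → Bool → S → ℝ) (R : S → ℝ) (H : ℕ)
    (n : Fin N) (t : ℕ) (x : S) : ℝ :=
  if t < H then R x + ∑ s' : S, P n x false s' * vPassive N P R H n (t+1) s' else 0
termination_by H - t
decreasing_by all_goals omega

theorem marginal_aux (N : ℕ) {S : Type} [Fintype S] (p : Fin N → S → ℝ)
    (hp : ∀ n, ∑ x, p n x = 1) (m : Fin N) (f : S → ℝ) :
    ∑ s' : Fin N → S, (∏ n, p n (s' n)) * f (s' m) = ∑ x, p m x * f x := by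
  classical
  have h1 : ∀ s' : Fin N → S, (∏ n, p n (s' n)) * f (s' m)
      = ∏ n, (p n (s' n) * if n = m then f (s' n) else 1) := by
    intro s'
    rw [Finset.prod_mul_distrib]
    simp
  simp_rw [h1]
  have h2 := Finset.prod_univ_sum (fun _ : Fin N => (Finset.univ : Finset S))
    (fun n x => p n x * if n = m then f x else 1)
  rw [Fintype.piFinset_univ] at h2
  rw [← h2, Finset.prod_eq_single m]
  · simp
  · intro n _ hn
    simp [hn, hp]
  · simp

theorem step_aux (N : ℕ) {S : Type} [Fintype S]
    (P : Fin N → S → Bool → S → ℝ)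
    (hP0 : ∀ (n : Fin N) (x : S) (a : Bool) (x' : S), 0 ≤ P n x a x')
    (hP1 : ∀ (n : Fin N) (x : S) (a : Bool), ∑ x' : S, P n x a x' = 1)
    (R : S → ℝ) (H : ℕ) (b : ℕ) (T : Finset (Fin N)) (hT : T.card ≤ b) (k : ℕ) :
    ∀ (t : ℕ) (s : Fin N → S), H - t = k →
    ∑ n, (if n ∈ T then vCharged N P R H n 0 t (s n) else vPassive N P R H n t (s n))
      ≤ Vval N P R H t s b := by
  induction k with
  | zero =>
    intro t s h
    have ht : ¬ t < H := by omega
    apply le_of_eq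
    rw [Vval, dif_neg ht]
    apply Finset.sum_eq_zero
    intro n _
    rw [vCharged, vPassive, dif_neg ht, if_neg ht, ite_self]
  | succ k ih =>
    intro t s h
    have ht : t < H := by omega
    have key : ∀ n, ∃ c : Bool, (c = true → n ∈ T) ∧
        (if n ∈ T then vCharged N P R H n 0 t (s n) else vPassive N P R H n t (s n))
        = R (s n) + ∑ x, P n (s n) c x *
          (if n ∈ T then vCharged N P R H n 0 (t+1) x else vPassive N P R H n (t+1) x) := by
      intro n
      by_cases hn : n ∈ T
      · simp only [hn, if_true]
        rw [vCharged, dif_pos ht]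
        rcases max_choice (R (s n) + ∑ s' : S, P n (s n) false s' * vCharged N P R H n 0 (t+1) s')
          ((R (s n) - (0 : Fin H → ℝ) ⟨t, ht⟩)
            + ∑ s' : S, P n (s n) true s' * vCharged N P R H n 0 (t+1) s') with h | h
        · exact ⟨false, by simp, h⟩
        · exact ⟨true, by simp, by rw [h]; simp⟩
      · refine ⟨false, by simp, ?_⟩
        simp only [hn, if_false]
        rw [vPassive, if_pos ht]
    choose a ha1 ha2 using key
    rw [Vval, dif_pos ht]
    refine le_trans ?_ (Finset.le_sup' _ (b := a) ?_)
    · rw [Finset.sum_congr rfl (fun n _ => ha2 n), Finset.sum_add_distrib]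
      gcongr
      rw [Finset.sum_congr rfl (fun n _ => (marginal_aux N (fun n x => P n (s n) (a n) x)
        (fun n => hP1 n _ _) n (fun x => if n ∈ T then vCharged N P R H n 0 (t+1) x
          else vPassive N P R H n (t+1) x)).symm), Finset.sum_comm]
      apply Finset.sum_le_sum
      intro s' _
      rw [← Finset.mul_sum]
      exact mul_le_mul_of_nonneg_left (ih (t+1) s' (by omega))
        (Finset.prod_nonneg fun n _ => hP0 _ _ _ _)
    · simp only [Finset.mem_filter, Finset.mem_univ, true_and]
      refine le_trans (Finset.card_le_card ?_) hT
      intro n hn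
      exact ha1 n (by simpa using hn)

theorem fixed_subset_policy_lower_bound
    (N : ℕ) (S : Type) [Fintype S] [Nonempty S]
    (P : Fin N → S → Bool → S → ℝ)
    (hP0 : ∀ (n : Fin N) (x : S) (a : Bool) (x' : S), 0 ≤ P n x a x')
    (hP1 : ∀ (n : Fin N) (x : S) (a : Bool), ∑ x' : S, P n x a x' = 1)
    (R : S → ℝ) (H : ℕ)
    (s : Fin N → S) (b : ℕ) (T : Finset (Fin N)) (hT : T.card ≤ b) :
    (∑ n ∈ T, vCharged N P R H n 0 0 (s n)) + (∑ n ∈ Tᶜ, vPassive N P R H n 0 (s n))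
      ≤ Vval N P R H 0 s b := by
  have h := step_aux N P hP0 hP1 R H b T hT (H - 0) 0 s rfl
  refine le_trans (le_of_eq ?_) h
  rw [← Finset.sum_add_sum_compl T]
  congr 1
  · exact Finset.sum_congr rfl fun n hn => by rw [if_pos hn]
  · exact Finset.sum_congr rfl fun n hn => by rw [if_neg (Finset.mem_compl.mp hn)]
end

section
/- Lower bound of Theorem 4: assume rewards are nonnegative, i.e., R x ≥ 0 for every state x : S. Then for every arm a : Fin N, every joint state s, and every budget b : ℕ, the single-arm value is dominated by the group value: vᵃ 0 (s a) b ≤ V 0 s b. -/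
open Finset

noncomputable def vSingle (N : ℕ) {S : Type} [Fintype S]
    (P : Fin N → S → Bool → S → ℝ) (R : S → ℝ) (H : ℕ)
    (a : Fin N) (t : ℕ) (x : S) (b : ℕ) : ℝ :=
  Vval 1 (fun _ => P a) R H t (fun _ => x) b

theorem aux_marg {N : ℕ} {S : Type} [Fintype S] (g : Fin N → S → ℝ)
    (hg : ∀ n, ∑ x, g n x = 1) (a : Fin N) (f : S → ℝ) :
    ∑ s' : Fin N → S, (∏ n, g n (s' n)) * f (s' a) = ∑ x, g a x * f x := by
  classical
  have h := Fintype.prod_sum (fun (n : Fin N) (x : S) => g n x * if n = a then f x else 1)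
  rw [Finset.prod_eq_single a] at h
  · simp only [if_true] at h
    rw [h]
    refine Finset.sum_congr rfl fun s' _ => ?_
    rw [Finset.prod_mul_distrib]
    simp
  · intro n _ hn
    simp [hn, hg]
  · simp

theorem aux_main
    (N : ℕ) (S : Type) [Fintype S]
    (P : Fin N → S → Bool → S → ℝ)
    (hP0 : ∀ (n : Fin N) (x : S) (a : Bool) (x' : S), 0 ≤ P n x a x')
    (hP1 : ∀ (n : Fin N) (x : S) (a : Bool), ∑ x' : S, P n x a x' = 1)
    (R : S → ℝ) (H : ℕ)
    (hR : ∀ x : S, 0 ≤ R x)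
    (a : Fin N) (b : ℕ) (k : ℕ) : ∀ (t : ℕ) (s : Fin N → S), H - t = k →
    Vval 1 (fun _ => P a) R H t (fun _ => s a) b ≤ Vval N P R H t s b := by
  classical
  induction k with
  | zero =>
    intro t s h
    have h' : ¬ t < H := by omega
    rw [Vval, Vval, dif_neg h', dif_neg h']
  | succ k ih =>
    intro t s h
    have h' : t < H := by omega
    rw [Vval, Vval.eq_def N, dif_pos h', dif_pos h']
    refine Finset.sup'_le _ _ fun α hα => ?_
    have hmem : (fun n : Fin N => if n = a then α 0 else false) ∈
        (Finset.univ.filter (fun a : Fin N → Bool =>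
        (Finset.univ.filter (fun n => a n = true)).card ≤ b)) := by
      simp only [Finset.mem_filter, Finset.mem_univ, true_and] at hα ⊢
      refine le_trans ?_ hα
      cases h0 : α 0
      · simp
      · simp [Finset.filter_eq']
        exact ⟨0, by simp [h0]⟩
    refine le_trans ?_ (Finset.le_sup' _ hmem)
    refine add_le_add ?_ ?_
    · rw [Fin.sum_univ_one]
      exact Finset.single_le_sum (f := fun n => R (s n)) (fun n _ => hR _) (Finset.mem_univ a)
    · have e1 := aux_marg (fun n => P n (s n) (if n = a then α 0 else false))
        (fun n => hP1 _ _ _) a (fun x => Vval 1 (fun _ => P a) R H (t+1) (fun _ => x) b)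
      have e2 := aux_marg (fun n : Fin 1 => P a (s a) (α n))
        (fun n => hP1 _ _ _) 0 (fun x => Vval 1 (fun _ => P a) R H (t+1) (fun _ => x) b)
      have e3 : ∀ s' : Fin 1 → S, (fun _ => s' 0) = s' := by
        intro s'; funext i; rw [Subsingleton.elim i 0]
      simp only [e3] at e2
      rw [if_pos rfl] at e1
      rw [e2, ← e1]
      refine Finset.sum_le_sum fun s' _ => ?_
      exact mul_le_mul_of_nonneg_left (ih (t+1) s' (by omega))
        (Finset.prod_nonneg fun n _ => hP0 _ _ _ _)

theorem single_arm_value_le_group_value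
    (N : ℕ) (S : Type) [Fintype S] [Nonempty S]
    (P : Fin N → S → Bool → S → ℝ)
    (hP0 : ∀ (n : Fin N) (x : S) (a : Bool) (x' : S), 0 ≤ P n x a x')
    (hP1 : ∀ (n : Fin N) (x : S) (a : Bool), ∑ x' : S, P n x a x' = 1)
    (R : S → ℝ) (H : ℕ)
    (hR : ∀ x : S, 0 ≤ R x)
    (a : Fin N) (s : Fin N → S) (b : ℕ) :
    vSingle N P R H a 0 (s a) b ≤ Vval N P R H 0 s b := by
  exact aux_main N S P hP0 hP1 R H hR a b _ 0 s rfl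
end
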